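/- arXiv:1501.05485 — 2 statements merged into one kernel-verified Lean document; each statement's English description precedes it below -/
import Mathlib

section
/- For every integer t with 0 ≤ t ≤ n(1−a), the variance of Y_t satisfies Var(Y_t) < (2/5)·n^{−1}. -/
/-!
The Markov chain `(Y_t)` with `Y_0 = a = j/n ∈ Q_n = {1/n, …, 1}` and, conditionally on
the past, `Y_{t+1} = Y_t + 1/n` with probability `Y_t` and `Y_{t+1} = Y_t` with probability
`1 - Y_t`.  Since `Y_t ∈ {a + k/n : 0 ≤ k ≤ t}`, its law is described by the probabilities
`ccrYProb n j t k = P(Y_t = (j+k)/n)`, given by the evident recursion.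
-/

/-- `ccrYProb n j t k` is the probability that `Y_t = (j + k)/n`, where `Y_0 = j/n`. -/
noncomputable def ccrYProb (n j : ℕ) : ℕ → ℕ → ℝ
  | 0, k => if k = 0 then 1 else 0
  | t + 1, k =>
      ccrYProb n j t k * (1 - ((j : ℝ) + k) / n) +
        (if k = 0 then 0 else ccrYProb n j t (k - 1) * (((j : ℝ) + (k - 1 : ℕ)) / n))

/-- The expectation `E[Y_t]`. -/
noncomputable def ccrYExp (n j t : ℕ) : ℝ :=
  ∑ k ∈ Finset.range (t + 1), (((j : ℝ) + k) / n) * ccrYProb n j t k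

/-- The variance `Var(Y_t)`. -/
noncomputable def ccrYVar (n j t : ℕ) : ℝ :=
  (∑ k ∈ Finset.range (t + 1), (((j : ℝ) + k) / n) ^ 2 * ccrYProb n j t k) - (ccrYExp n j t) ^ 2

/-- The chain started at `j / n` cannot move up more than `t` times in `t` steps. -/
lemma ccrYProb_eq_zero_of_lt (n j : ℕ) {t k : ℕ} (h : t < k) : ccrYProb n j t k = 0 := by
  induction t generalizing k with
  | zero => simp [ccrYProb, h.ne']
  | succ t ih =>
    have hk : k ≠ 0 := by omega
    simp only [ccrYProb, hk, if_false]
    rw [ih (by omega), ih (by omega)]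
    simp

/-- One-step recursion for the expectation of a function of the chain. -/
lemma sum_mul_ccrYProb_succ (n j t : ℕ) (g : ℕ → ℝ) :
    ∑ k ∈ Finset.range (t + 2), g k * ccrYProb n j (t + 1) k =
      ∑ k ∈ Finset.range (t + 1),
        (g k * (1 - ((j : ℝ) + k) / n) + g (k + 1) * (((j : ℝ) + k) / n)) *
          ccrYProb n j t k := by
  have h1 : ∑ k ∈ Finset.range (t + 2), g k * (ccrYProb n j t k * (1 - ((j : ℝ) + k) / n)) =
      ∑ k ∈ Finset.range (t + 1), g k * (ccrYProb n j t k * (1 - ((j : ℝ) + k) / n)) := by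
    rw [Finset.sum_range_succ, ccrYProb_eq_zero_of_lt n j (Nat.lt_succ_self t)]
    simp
  simp only [ccrYProb, mul_add, Finset.sum_add_distrib]
  rw [h1, Finset.sum_range_succ' (fun k => g k * if k = 0 then (0 : ℝ) else _)]
  simp only [Nat.add_eq_zero_iff, one_ne_zero, and_false, if_false, if_true, mul_zero, add_zero,
    Nat.add_sub_cancel, ← Finset.sum_add_distrib]
  exact Finset.sum_congr rfl fun k _ => by ring

lemma sum_ccrYProb_first_moment (n j t : ℕ) :
    ∑ k ∈ Finset.range (t + 1), ((j : ℝ) + k) * ccrYProb n j t k =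
      j * (1 + 1 / (n : ℝ)) ^ t := by
  induction t with
  | zero => simp [ccrYProb]
  | succ t ih =>
    rw [sum_mul_ccrYProb_succ, pow_succ, ← mul_assoc, ← ih, Finset.sum_mul]
    refine Finset.sum_congr rfl fun k _ => ?_
    push_cast
    ring

lemma sum_ccrYProb_rising_second_moment (n j t : ℕ) :
    ∑ k ∈ Finset.range (t + 1), (((j : ℝ) + k) * (j + k + 1)) * ccrYProb n j t k =
      j * (j + 1) * (1 + 2 / (n : ℝ)) ^ t := by
  induction t with
  | zero => simp [ccrYProb]
  | succ t ih =>
    rw [sum_mul_ccrYProb_succ n j t (fun k => ((j : ℝ) + k) * (j + k + 1)), pow_succ,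
      ← mul_assoc, ← ih, Finset.sum_mul]
    refine Finset.sum_congr rfl fun k _ => ?_
    push_cast
    ring

/-- Closed form of the variance. -/
lemma ccrYVar_eq (n j t : ℕ) :
    ccrYVar n j t = (j * (j + 1) * (1 + 2 / (n : ℝ)) ^ t - j * (1 + 1 / (n : ℝ)) ^ t -
      (j * (1 + 1 / (n : ℝ)) ^ t) ^ 2) / (n : ℝ) ^ 2 := by
  have hE : ccrYExp n j t = j * (1 + 1 / (n : ℝ)) ^ t / n := by
    rw [← sum_ccrYProb_first_moment, ccrYExp, Finset.sum_div]
    exact Finset.sum_congr rfl fun k _ => by ring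
  rw [ccrYVar, hE, ← sum_ccrYProb_rising_second_moment]
  nth_rewrite 2 [← sum_ccrYProb_first_moment]
  rw [← Finset.sum_sub_distrib, sub_div, div_pow, Finset.sum_div]
  congr 1
  exact Finset.sum_congr rfl fun k _ => by ring

/-- Comparison of the two growth rates, from Bernoulli's inequality. -/
lemma one_add_two_div_pow_mul_le {n : ℝ} (hn : 0 < n) (t : ℕ) :
    (1 + 2 / n) ^ t * (n * (n + 2) + t) ≤ ((1 + 1 / n) ^ t) ^ 2 * (n * (n + 2)) := by
  have hM : 0 < n * (n + 2) := by positivity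
  have hb : 1 + (t : ℝ) * (1 / (n * (n + 2))) ≤ (1 + 1 / (n * (n + 2))) ^ t :=
    one_add_mul_le_pow (by linarith [show 0 < 1 / (n * (n + 2)) by positivity]) t
  have hr : ((1 + 1 / n) ^ t) ^ 2 = (1 + 2 / n) ^ t * (1 + 1 / (n * (n + 2))) ^ t := by
    rw [← pow_mul, mul_comm t 2, pow_mul, ← mul_pow]
    congr 1
    field_simp
    ring
  calc (1 + 2 / n) ^ t * (n * (n + 2) + t)
      = (1 + 2 / n) ^ t * (1 + (t : ℝ) * (1 / (n * (n + 2)))) * (n * (n + 2)) := by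
        field_simp
    _ ≤ ((1 + 1 / n) ^ t) ^ 2 * (n * (n + 2)) := by
        rw [hr]
        gcongr

/-- Chord bound for the exponential on `[0, b]`. -/
lemma exp_sub_one_le_chord {b c x : ℝ} (hx : 0 ≤ x) (hxb : x ≤ b) (hb : 0 < b)
    (hc : Real.exp b ≤ 1 + c * b) : Real.exp x - 1 ≤ c * x := by
  have h := convexOn_exp.2 (Set.mem_univ (0 : ℝ)) (Set.mem_univ b)
    (show 0 ≤ 1 - x / b by rw [sub_nonneg, div_le_one hb]; exact hxb)
    (show 0 ≤ x / b by positivity) (by ring)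
  simp only [smul_eq_mul, mul_zero, zero_add, Real.exp_zero, mul_one] at h
  rw [div_mul_cancel₀ x hb.ne'] at h
  have h2 : x / b * Real.exp b ≤ x / b * (1 + c * b) := by gcongr
  have h3 : x / b * (1 + c * b) = x / b + c * x := by field_simp
  linarith

/-- Maximizing the limiting variance over `a` for a fixed time `x`. -/
lemma limit_variance_lt_of_chord {a x E κ c : ℝ} (hx : 0 ≤ x) (hE : E - 1 ≤ c * x)
    (ha : 0 ≤ a) (hE0 : 0 ≤ E) (hκ : 0 < κ) (hc : c ^ 2 * x < 8 / 5 * κ) :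
    a * (E * (E * (1 - κ * a * x) - 1)) < 2 / 5 := by
  have hw : 0 ≤ a * E := by positivity
  have h1 : a * E * (E - 1) ≤ a * E * (c * x) := by gcongr
  have h2 : 0 ≤ x * (2 * κ * (a * E) - c) ^ 2 := by positivity
  have h3 : 4 * κ * (a * (E * (E * (1 - κ * a * x) - 1))) < 4 * κ * (2 / 5) := by
    nlinarith
  exact lt_of_mul_lt_mul_left h3 (by positivity)

lemma exp_le_quadratic {y : ℝ} (h1 : -(9 / 100) ≤ y) (h2 : y ≤ 1 / 5) :
    Real.exp y ≤ 1 + y + 11 / 20 * y ^ 2 := by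
  have habs : |y| ≤ 1 / 5 := abs_le.2 ⟨by linarith, h2⟩
  have h := Real.exp_bound (x := y) (by linarith) (n := 3) (by norm_num)
  have h' := (abs_le.1 h).2
  norm_num [Finset.sum_range_succ, Nat.factorial] at h'
  have h3 : |y| ^ 3 ≤ 1 / 5 * y ^ 2 := by
    rw [pow_succ, sq_abs]
    nlinarith [sq_nonneg y]
  nlinarith [sq_nonneg y]

lemma exp_div_le_of_pow_le {p q : ℕ} {c : ℝ} (hc : 0 ≤ c) (hq : q ≠ 0)
    (h : (2.7182818286 : ℝ) ^ p ≤ c ^ q) : Real.exp ((p : ℝ) / q) ≤ c := by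
  refine le_of_pow_le_pow_left₀ hq hc (le_trans ?_ h)
  have hq' : (q : ℝ) ≠ 0 := by exact_mod_cast hq
  rw [← Real.exp_nat_mul, mul_div_cancel₀ _ hq', ← mul_one (p : ℝ), Real.exp_nat_mul]
  gcongr
  exact Real.exp_one_lt_d9.le

lemma exp_four_fifths_le : Real.exp (4 / 5) ≤ 2.226 := by
  exact_mod_cast exp_div_le_of_pow_le (p := 4) (q := 5) (c := 2.226)
    (by norm_num) (by norm_num) (by norm_num)

lemma exp_le_late {x : ℝ} (h1 : 71 / 100 ≤ x) (h2 : x ≤ 1) :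
    Real.exp x ≤ 2.226 * (1 + (x - 4 / 5) + 11 / 20 * (x - 4 / 5) ^ 2) := by
  have hy := exp_le_quadratic (y := x - 4 / 5) (by linarith) (by linarith)
  have : Real.exp x = Real.exp (4 / 5) * Real.exp (x - 4 / 5) := by
    rw [← Real.exp_add]; congr 1; ring
  rw [this]
  exact mul_le_mul exp_four_fifths_le hy (Real.exp_pos _).le (by norm_num)

lemma exp_early_le : Real.exp (31 / 50) ≤ 1 + 1.388 * (31 / 50) := by
  exact_mod_cast exp_div_le_of_pow_le (p := 31) (q := 50) (c := 1 + 1.388 * (31 / 50))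
    (by norm_num) (by norm_num) (by norm_num)

/-- `E ↦ E (E γ - 1)` is increasing for `E ≥ 1`, `γ ≥ 1/2`. -/
lemma mul_mul_sub_one_mono {R E γ : ℝ} (hR : 1 ≤ R) (hRE : R ≤ E) (hγ : 1 / 2 ≤ γ) :
    R * (R * γ - 1) ≤ E * (E * γ - 1) := by
  have h : 0 ≤ (E - R) * ((E + R) * γ - 1) :=
    mul_nonneg (by linarith) (by nlinarith)
  linarith

lemma late_polynomial_lt {x : ℝ} (h1 : 18 / 25 ≤ x) :
    (1 - x) * ((2.226 * (1 + (x - 4 / 5) + 11 / 20 * (x - 4 / 5) ^ 2)) *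
      ((2.226 * (1 + (x - 4 / 5) + 11 / 20 * (x - 4 / 5) ^ 2)) * (1 - (1 - x) * x) - 1))
      < 2 / 5 := by
  obtain ⟨z, rfl⟩ : ∃ z, x = 18 / 25 + z := ⟨x - 18 / 25, by ring⟩
  have hz : 0 ≤ z := by linarith
  linarith [pow_nonneg hz 3, pow_nonneg hz 4, pow_nonneg hz 5, pow_nonneg hz 6,
    pow_nonneg hz 7, sq_nonneg (z - 97 / 1000)]

/-- The limiting variance at late times, where the extremal `a` is `1 - x`. -/
lemma limit_variance_lt_of_late {a x : ℝ} (ha : 0 ≤ a) (hax : a ≤ 1 - x)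
    (hx : 18 / 25 ≤ x) :
    a * (Real.exp x * (Real.exp x * (1 - a * x) - 1)) < 2 / 5 := by
  have hx1 : x ≤ 1 := by linarith
  have hE2 : 1 + x + x ^ 2 / 2 ≤ Real.exp x := Real.quadratic_le_exp_of_nonneg (by linarith)
  have hE1 : 17 / 10 < Real.exp x := by nlinarith
  have hγ : 3 / 4 ≤ 1 - (1 - x) * x := by nlinarith [sq_nonneg (2 * x - 1)]
  have hmono : a * (Real.exp x * (Real.exp x * (1 - a * x) - 1)) ≤
      (1 - x) * (Real.exp x * (Real.exp x * (1 - (1 - x) * x) - 1)) := by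
    have hs : (a + (1 - x)) * x ≤ 0.41 := by nlinarith
    have : 0 ≤ ((1 - x) - a) * (Real.exp x * (Real.exp x * (1 - (a + (1 - x)) * x) - 1)) :=
      mul_nonneg (by linarith) (mul_nonneg (by linarith) (by nlinarith))
    linarith
  have hL := mul_mul_sub_one_mono (by linarith) (exp_le_late (by linarith) hx1)
    (show 1 / 2 ≤ 1 - (1 - x) * x by linarith)
  exact (hmono.trans (mul_le_mul_of_nonneg_left hL (by linarith))).trans_lt
    (late_polynomial_lt hx)

/-- The limiting variance with the correction factor `κ` that covers all finite `n`. -/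
lemma limit_variance_lt {a x κ : ℝ} (ha : 0 ≤ a) (hx : 0 ≤ x) (hax : a ≤ 1 - x)
    (hκ : κ = 1 ∨ κ = 3 / 4 ∧ 19 / 50 ≤ a) :
    a * (Real.exp x * (Real.exp x * (1 - κ * a * x) - 1)) < 2 / 5 := by
  rcases hκ with rfl | ⟨rfl, ha'⟩
  · rcases le_total x (18 / 25) with h | h
    · have hc : Real.exp (18 / 25) ≤ 1 + 1.47 * (18 / 25) :=
        (exp_le_late (by norm_num) (by norm_num)).trans (by norm_num)
      exact limit_variance_lt_of_chord hx (exp_sub_one_le_chord hx h (by norm_num) hc) ha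
        (Real.exp_pos x).le one_pos (by linarith)
    · simpa using limit_variance_lt_of_late ha hax h
  · have h : x ≤ 31 / 50 := by linarith
    exact limit_variance_lt_of_chord hx
      (exp_sub_one_le_chord hx h (by norm_num) exp_early_le) ha
      (Real.exp_pos x).le (by norm_num) (by linarith)

/-- The finite-`n` correction term is at least `κ a x`, where `a = j / n` and `x = t / n`. -/
lemma exists_correction_factor {n j t : ℝ} (hn : 2 ≤ n) (hj : 0 < j) (ht : 0 ≤ t)
    (hjt : j + t ≤ n) :
    ∃ κ : ℝ, (κ = 1 ∨ κ = 3 / 4 ∧ 19 / 50 ≤ j / n) ∧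
      κ * (j / n) * (t / n) * (n * (n + 2) + t) ≤ (j + 1) * t := by
  have hn0 : 0 < n := by linarith
  have key : ∀ κ : ℝ, κ * j * (n * (n + 2) + t) ≤ (j + 1) * n ^ 2 →
      κ * (j / n) * (t / n) * (n * (n + 2) + t) ≤ (j + 1) * t := by
    intro κ h
    have : κ * (j / n) * (t / n) * (n * (n + 2) + t) =
        (κ * j * (n * (n + 2) + t)) * t / n ^ 2 := by field_simp
    rw [this, div_le_iff₀ (by positivity)]
    nlinarith
  rcases le_total (j / n) (19 / 50) with h | h
  · refine ⟨1, Or.inl rfl, key _ ?_⟩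
    rw [div_le_iff₀ hn0] at h
    nlinarith
  · refine ⟨3 / 4, Or.inr ⟨rfl, h⟩, key _ ?_⟩
    have h1 : j * t ≤ j * (n - j) := by gcongr; linarith
    have h2 : j ≤ n := by linarith
    nlinarith [mul_nonneg hj.le (sub_nonneg.2 h2), sq_nonneg (n - j),
      mul_nonneg (mul_nonneg hj.le hn0.le) (sub_nonneg.2 hn),
      mul_nonneg hn0.le (sub_nonneg.2 h2)]

/-- For every integer `t` with `0 ≤ t ≤ n(1-a)`, where `a = j/n ∈ Q_n`,
`Var(Y_t) < (2/5)·n⁻¹`. -/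
theorem ccrY_variance_lt (n j : ℕ) (hn : 1 ≤ n) (hj1 : 1 ≤ j) (hjn : j ≤ n)
    (t : ℕ) (ht : t ≤ n - j) :
    ccrYVar n j t < (2 / 5) * (n : ℝ)⁻¹ := by
  have hn0 : (0 : ℝ) < n := by exact_mod_cast hn
  have hj0 : (0 : ℝ) < j := by exact_mod_cast hj1
  have hjt : (j : ℝ) + t ≤ n := by exact_mod_cast (by omega : j + t ≤ n)
  rcases Nat.eq_zero_or_pos t with rfl | htpos
  · have : ccrYVar n j 0 = 0 := by rw [ccrYVar_eq]; ring
    rw [this]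
    positivity
  have hn2 : (2 : ℝ) ≤ n := by exact_mod_cast (by omega : 2 ≤ n)
  obtain ⟨κ, hκ, hcorr⟩ := exists_correction_factor hn2 hj0 (Nat.cast_nonneg t) hjt
  have ha : 0 ≤ (j : ℝ) / n := by positivity
  have hx : 0 ≤ (t : ℝ) / n := by positivity
  have hax : (j : ℝ) / n ≤ 1 - (t : ℝ) / n := by
    rw [le_sub_iff_add_le, ← add_div, div_le_one hn0]
    exact hjt
  have hlim := limit_variance_lt ha hx hax hκ
  have hpow := one_add_two_div_pow_mul_le hn0 t
  have hR1 : 1 ≤ (1 + 1 / (n : ℝ)) ^ t := one_le_pow₀ (by simp)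
  have hRE : (1 + 1 / (n : ℝ)) ^ t ≤ Real.exp ((t : ℝ) / n) := by
    calc (1 + 1 / (n : ℝ)) ^ t ≤ Real.exp (1 / n) ^ t := by
          gcongr
          rw [add_comm]
          exact Real.add_one_le_exp _
      _ = Real.exp ((t : ℝ) / n) := by rw [← Real.exp_nat_mul]; congr 1; ring
  rw [ccrYVar_eq]
  set R := (1 + 1 / (n : ℝ)) ^ t
  set S := (1 + 2 / (n : ℝ)) ^ t
  set a := (j : ℝ) / n with ha_def
  set x := (t : ℝ) / n
  have hγ : 1 / 2 ≤ 1 - κ * a * x := by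
    have hax4 : a * x ≤ 1 / 4 := by nlinarith [sq_nonneg (a - x)]
    have hax0 : 0 ≤ a * x := by positivity
    rcases hκ with h | ⟨h, -⟩ <;> rw [h] <;> linarith
  have hM : 0 < (n : ℝ) * (n + 2) + t := by positivity
  have hS : (j + 1) * S - R - j * R ^ 2 ≤ R * (R * (1 - κ * a * x) - 1) := by
    refine le_of_mul_le_mul_right ?_ hM
    have h1 : (j + 1) * (S * ((n : ℝ) * (n + 2) + t)) ≤
        (j + 1) * (R ^ 2 * (n * (n + 2))) := by gcongr
    have h2 := mul_le_mul_of_nonneg_left hcorr (sq_nonneg R)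
    linarith
  have hfin : a * ((j + 1) * S - R - j * R ^ 2) < 2 / 5 :=
    (mul_le_mul_of_nonneg_left (hS.trans (mul_mul_sub_one_mono hR1 hRE hγ)) ha).trans_lt hlim
  have heq : (j * (j + 1) * S - j * R - (j * R) ^ 2) / (n : ℝ) ^ 2 =
      a * ((j + 1) * S - R - j * R ^ 2) * (n : ℝ)⁻¹ := by
    rw [ha_def]
    field_simp
  rw [heq]
  gcongr
end

section
/- For every integer n ≥ 10⁵, the second largest eigenvalue (in the decreasing enumeration, with multiplicity, of the n real eigenvalues) of the real symmetric matrix S(n) := (B(n) + B(n)ᵀ)/2 is at least 0.21. -/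
/-- The function `G_b : [0,1] → [0,1]`, with breakpoint `u₀(b) = 1 - (1-b)e^b`:
`G_b(u) = e^{1-b}·u` for `u ≤ u₀(b)` and
`G_b(u) = e^{e^{-b}(1-u)} - (1-u)·e^{1-b}` for `u > u₀(b)`.  For `a ∈ (0,1]` it is a
strictly increasing continuous bijection of `[0,1]` onto itself. -/
noncomputable def Gfun (b u : ℝ) : ℝ :=
  if u ≤ 1 - (1 - b) * Real.exp b then Real.exp (1 - b) * u
  else Real.exp (Real.exp (-b) * (1 - u)) - (1 - u) * Real.exp (1 - b)

/-- The inverse `G_a⁻¹` of `G_a`. -/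
noncomputable def Ginv (a : ℝ) : ℝ → ℝ := Function.invFun (Gfun a)

/-- The doubly stochastic `n × n` matrix `B(n) = [b_{ij}]`, rows and columns indexed by
`Q_n = {1/n, …, 1}` via `i ↦ (i+1)/n`: `b_{ij}` is the probability that `G_a(V)` lies in
`(j - 1/n, j]` when `a` is uniform on `(i - 1/n, i)` and `V` is uniform on `[0,1]`,
independently, i.e. `b_{ij} = n·∫_{i-1/n}^{i} (G_a⁻¹(j) - G_a⁻¹(j - 1/n)) da`. -/
noncomputable def Bmat (n : ℕ) : Matrix (Fin n) (Fin n) ℝ := fun i j =>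
  n * ∫ a in ((i.val : ℝ) / n)..(((i.val : ℝ) + 1) / n),
    (Ginv a (((j.val : ℝ) + 1) / n) - Ginv a ((j.val : ℝ) / n))

open MeasureTheory Set intervalIntegral

lemma Gfun_eq_left {a u : ℝ} (hu : u ≤ 1 - (1 - a) * Real.exp a) :
    Gfun a u = Real.exp (1 - a) * u := if_pos hu

lemma Gfun_eq_right {a u : ℝ} (hu : 1 - (1 - a) * Real.exp a ≤ u) :
    Gfun a u = Real.exp (Real.exp (-a) * (1 - u)) - (1 - u) * Real.exp (1 - a) := by
  rcases hu.eq_or_lt with rfl | hu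
  · have h : Real.exp (-a) * ((1 - a) * Real.exp a) = 1 - a := by
      rw [mul_left_comm, ← Real.exp_add]; simp
    rw [Gfun_eq_left le_rfl, sub_sub_cancel, h]
    ring
  · exact if_neg hu.not_ge

lemma continuous_Gfun (a : ℝ) : Continuous (Gfun a) := by
  refine Continuous.if_le (by fun_prop) (by fun_prop) continuous_id continuous_const ?_
  intro u hu
  have := Gfun_eq_right (a := a) (u := u) hu.ge
  rwa [Gfun_eq_left hu.le] at this

lemma strictMono_Gfun {a : ℝ} (ha : 0 ≤ a) : StrictMono (Gfun a) := by
  refine StrictMonoOn.Iic_union_Ici (a := 1 - (1 - a) * Real.exp a) ?_ ?_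
  · intro u hu v hv huv
    rw [Gfun_eq_left hu, Gfun_eq_left hv]
    gcongr
  · refine strictMonoOn_of_deriv_pos (convex_Ici _) (continuous_Gfun a).continuousOn ?_
    intro u hu
    rw [interior_Ici] at hu
    have hlt : 1 - u < (1 - a) * Real.exp a := by
      have : 1 - (1 - a) * Real.exp a < u := hu
      linarith
    have hd : HasDerivAt
        (fun u => Real.exp (Real.exp (-a) * (1 - u)) - (1 - u) * Real.exp (1 - a))
        (Real.exp (Real.exp (-a) * (1 - u)) * (Real.exp (-a) * (-1)) - (-1) * Real.exp (1 - a))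
        u := by
      have h1 : HasDerivAt (fun u : ℝ => 1 - u) (-1) u := by
        simpa using (hasDerivAt_id u).const_sub 1
      exact (h1.const_mul _).exp.sub (h1.mul_const _)
    have he : Gfun a =ᶠ[nhds u]
        fun u => Real.exp (Real.exp (-a) * (1 - u)) - (1 - u) * Real.exp (1 - a) := by
      filter_upwards [Ioi_mem_nhds hu] with v hv using Gfun_eq_right (le_of_lt hv)
    rw [(hd.congr_of_eventuallyEq he).deriv]
    have h2 : Real.exp (-a) * (1 - u) < 1 := by
      have : Real.exp (-a) * (1 - u) < Real.exp (-a) * ((1 - a) * Real.exp a) := by gcongr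
      rw [mul_left_comm, ← Real.exp_add] at this
      simp at this
      linarith
    have h3 := Real.exp_lt_exp.2 h2
    have h4 : Real.exp (1 - a) = Real.exp 1 * Real.exp (-a) := by
      rw [← Real.exp_add, sub_eq_add_neg]
    rw [h4]
    nlinarith [Real.exp_pos (-a)]

lemma breakpoint_nonneg (a : ℝ) : 0 ≤ 1 - (1 - a) * Real.exp a := by
  have h := Real.add_one_le_exp (-a)
  have h2 : (1 - a) * Real.exp a ≤ Real.exp (-a) * Real.exp a := by gcongr; linarith
  rw [← Real.exp_add] at h2
  simp at h2
  linarith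

lemma breakpoint_le_one {a : ℝ} (ha : a ≤ 1) : 1 - (1 - a) * Real.exp a ≤ 1 := by
  nlinarith [Real.exp_pos a]

lemma Gfun_zero (a : ℝ) : Gfun a 0 = 0 := by
  rw [Gfun_eq_left (breakpoint_nonneg a), mul_zero]

lemma Gfun_one {a : ℝ} (ha : a ≤ 1) : Gfun a 1 = 1 := by
  rw [Gfun_eq_right (breakpoint_le_one ha)]
  simp

lemma Ginv_Gfun {a : ℝ} (ha : 0 ≤ a) (u : ℝ) : Ginv a (Gfun a u) = u :=
  Function.leftInverse_invFun (strictMono_Gfun ha).injective u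

lemma Ginv_zero {a : ℝ} (ha : 0 ≤ a) : Ginv a 0 = 0 := by
  simpa [Gfun_zero] using Ginv_Gfun ha 0

lemma Ginv_one {a : ℝ} (ha : a ∈ Icc (0 : ℝ) 1) : Ginv a 1 = 1 := by
  simpa [Gfun_one ha.2] using Ginv_Gfun ha.1 1

lemma Gfun_Ginv {a : ℝ} (ha : a ∈ Icc (0 : ℝ) 1) {x : ℝ} (hx : x ∈ Icc (0 : ℝ) 1) :
    Gfun a (Ginv a x) = x := by
  have h := intermediate_value_Icc zero_le_one (continuous_Gfun a).continuousOn
  rw [Gfun_zero, Gfun_one ha.2] at h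
  obtain ⟨u, -, hu⟩ := h hx
  rw [← hu, Ginv_Gfun ha.1]

lemma Ginv_le_iff {a : ℝ} (ha : a ∈ Icc (0 : ℝ) 1) {x : ℝ} (hx : x ∈ Icc (0 : ℝ) 1) (u : ℝ) :
    Ginv a x ≤ u ↔ x ≤ Gfun a u := by
  rw [← (strictMono_Gfun ha.1).le_iff_le, Gfun_Ginv ha hx]

lemma Ginv_mono {a : ℝ} (ha : a ∈ Icc (0 : ℝ) 1) {x y : ℝ} (hx : x ∈ Icc (0 : ℝ) 1)
    (hy : y ∈ Icc (0 : ℝ) 1) (hxy : x ≤ y) : Ginv a x ≤ Ginv a y := by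
  rwa [Ginv_le_iff ha hx, Gfun_Ginv ha hy]

lemma Ginv_mem {a : ℝ} (ha : a ∈ Icc (0 : ℝ) 1) {x : ℝ} (hx : x ∈ Icc (0 : ℝ) 1) :
    Ginv a x ∈ Icc (0 : ℝ) 1 := by
  constructor
  · simpa [Ginv_zero ha.1] using Ginv_mono ha (by simp) hx hx.1
  · simpa [Ginv_one ha] using Ginv_mono ha hx (by simp) hx.2

lemma measurable_Gfun_left (u : ℝ) : Measurable fun a => Gfun a u := by
  unfold Gfun
  refine Measurable.ite (measurableSet_le measurable_const ?_) ?_ ?_ <;> fun_prop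

lemma integrableOn_Ginv {x : ℝ} (hx : x ∈ Icc (0 : ℝ) 1) :
    IntegrableOn (fun a => Ginv a x) (Icc 0 1) := by
  have hm : Measurable ((Icc (0 : ℝ) 1).indicator fun a => Ginv a x) := by
    refine measurable_of_Iic fun u => ?_
    have : (Icc (0 : ℝ) 1).indicator (fun a => Ginv a x) ⁻¹' Iic u =
        (Icc 0 1 ∩ {a | x ≤ Gfun a u}) ∪ ((Icc 0 1)ᶜ ∩ {_a | 0 ≤ u}) := by
      ext a
      by_cases ha : a ∈ Icc (0 : ℝ) 1
      · simp [-mem_Icc, ha, Ginv_le_iff ha hx]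
      · simp [-mem_Icc, ha]
    rw [this]
    exact (measurableSet_Icc.inter (measurableSet_le measurable_const
      (measurable_Gfun_left u))).union (measurableSet_Icc.compl.inter (MeasurableSet.const _))
  rw [← integrable_indicator_iff measurableSet_Icc]
  refine Integrable.mono' (g := (Icc (0 : ℝ) 1).indicator fun _ => 1) ?_
    hm.aestronglyMeasurable (Filter.Eventually.of_forall fun a => ?_)
  · rw [integrable_indicator_iff measurableSet_Icc]
    exact integrableOn_const (by simp)
  · by_cases ha : a ∈ Icc (0 : ℝ) 1
    · have := Ginv_mem ha hx
      simpa [-mem_Icc, ha, abs_of_nonneg this.1] using this.2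
    · simp [-mem_Icc, ha]

/-- A Riemann-sum estimate over an arbitrary partition of the unit interval. -/
lemma abs_sum_integral_sub_le {n : ℕ} {p : ℕ → ℝ} {k : ℕ → ℝ → ℝ} {g : ℝ → ℝ} {ε : ℝ}
    (hp : ∀ i < n, p i ≤ p (i + 1)) (h0 : p 0 = 0) (h1 : p n = 1)
    (hk : ∀ i < n, IntervalIntegrable (k i) volume (p i) (p (i + 1)))
    (hg : Continuous g)
    (h : ∀ i < n, ∀ x ∈ Icc (p i) (p (i + 1)), |k i x - g x| ≤ ε) :
    |∑ i ∈ Finset.range n, (∫ x in (p i)..(p (i + 1)), k i x) - ∫ x in (0 : ℝ)..1, g x| ≤ ε := by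
  rw [← h0, ← h1, ← sum_integral_adjacent_intervals
    (fun i _ => hg.intervalIntegrable _ _), ← Finset.sum_sub_distrib]
  calc _ ≤ ∑ i ∈ Finset.range n, ε * (p (i + 1) - p i) := by
        refine (Finset.abs_sum_le_sum_abs _ _).trans (Finset.sum_le_sum fun i hi => ?_)
        have hi := Finset.mem_range.1 hi
        rw [← integral_sub (hk i hi) (hg.intervalIntegrable _ _),
          ← abs_of_nonneg (sub_nonneg.2 (hp i hi))]
        refine intervalIntegral.norm_integral_le_of_norm_le_const
          (f := fun x => k i x - g x) fun x hx => ?_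
        rw [uIoc_of_le (hp i hi)] at hx
        exact h i hi x (Ioc_subset_Icc_self hx)
    _ = ε := by rw [← Finset.mul_sum, Finset.sum_range_sub, h0, h1]; ring

/-- Splitting an integral along `Gfun a` at its breakpoint. -/
lemma integral_comp_Gfun {a : ℝ} (ha : a ≤ 1) {φ : ℝ → ℝ} (hφ : Continuous φ) :
    ∫ v in (0 : ℝ)..1, φ (Gfun a v) =
      (∫ v in (0 : ℝ)..(1 - (1 - a) * Real.exp a), φ (Real.exp (1 - a) * v)) +
      ∫ v in (1 - (1 - a) * Real.exp a)..1,
        φ (Real.exp (Real.exp (-a) * (1 - v)) - (1 - v) * Real.exp (1 - a)) := by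
  have hc : Continuous fun v => φ (Gfun a v) := hφ.comp (continuous_Gfun a)
  rw [← integral_add_adjacent_intervals (hc.intervalIntegrable _ (1 - (1 - a) * Real.exp a))
    (hc.intervalIntegrable _ _)]
  congr 1
  · refine integral_congr fun v hv => ?_
    rw [uIcc_of_le (breakpoint_nonneg a)] at hv
    simp only [Gfun_eq_left hv.2]
  · refine integral_congr fun v hv => ?_
    rw [uIcc_of_le (breakpoint_le_one ha)] at hv
    simp only [Gfun_eq_right hv.1]

lemma hasDerivAt_one_sub (v : ℝ) : HasDerivAt (fun v : ℝ => 1 - v) (-1) v := by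
  simpa using (hasDerivAt_id v).const_sub 1

lemma integral_Gfun {a : ℝ} (ha : a ≤ 1) :
    ∫ v in (0 : ℝ)..1, Gfun a v =
      Real.exp 1 * Real.exp (-a) / 2 + a * Real.exp 1 - Real.exp a := by
  have h1a : Real.exp (1 - a) = Real.exp 1 * Real.exp (-a) := by
    rw [← Real.exp_add, sub_eq_add_neg]
  have hpos := Real.exp_pos a
  rw [integral_comp_Gfun ha (φ := fun x => x) continuous_id]
  have hleft : ∀ v ∈ uIcc 0 (1 - (1 - a) * Real.exp a),
      HasDerivAt (fun v => Real.exp (1 - a) * (v ^ 2 / 2)) (Real.exp (1 - a) * v) v := by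
    intro v _
    refine (((hasDerivAt_pow 2 v).div_const 2).const_mul _).congr_deriv ?_
    norm_num
  have hright : ∀ v ∈ uIcc (1 - (1 - a) * Real.exp a) 1,
      HasDerivAt (fun v => -(Real.exp a * Real.exp (Real.exp (-a) * (1 - v)))
          + Real.exp (1 - a) * ((1 - v) ^ 2 / 2))
        (Real.exp (Real.exp (-a) * (1 - v)) - (1 - v) * Real.exp (1 - a)) v := by
    intro v _
    have h := hasDerivAt_one_sub v
    refine (((h.const_mul (Real.exp (-a))).exp.const_mul (Real.exp a)).neg.add
      (((h.pow 2).div_const 2).const_mul (Real.exp (1 - a)))).congr_deriv ?_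
    rw [Real.exp_neg]
    field_simp
    norm_num
    ring
  rw [integral_eq_sub_of_hasDerivAt hleft (Continuous.intervalIntegrable (by fun_prop) _ _),
    integral_eq_sub_of_hasDerivAt hright (Continuous.intervalIntegrable (by fun_prop) _ _)]
  have h : Real.exp (-a) * ((1 - a) * Real.exp a) = 1 - a := by
    rw [mul_left_comm, ← Real.exp_add]; simp
  simp only [sub_sub_cancel, h, sub_self, mul_zero, Real.exp_zero]
  rw [h1a, Real.exp_neg]
  field_simp
  ring

lemma integral_Gfun_sq {a : ℝ} (ha : a ≤ 1) :
    ∫ v in (0 : ℝ)..1, Gfun a v ^ 2 =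
      Real.exp 1 ^ 2 * Real.exp (-a) ^ 2 / 3 + (a - 1 / 2) * Real.exp 1 ^ 2 * Real.exp (-a)
        + (1 + a ^ 2) * Real.exp 1 ^ 2 - (1 / 2 + 2 * Real.exp 1) * Real.exp a := by
  have h1a : Real.exp (1 - a) = Real.exp 1 * Real.exp (-a) := by
    rw [← Real.exp_add, sub_eq_add_neg]
  have hpos := Real.exp_pos a
  rw [integral_comp_Gfun ha (φ := fun x => x ^ 2) (by fun_prop)]
  have hleft : ∀ v ∈ uIcc 0 (1 - (1 - a) * Real.exp a),
      HasDerivAt (fun v => Real.exp (1 - a) ^ 2 * (v ^ 3 / 3)) ((Real.exp (1 - a) * v) ^ 2) v := by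
    intro v _
    refine (((hasDerivAt_pow 3 v).div_const 3).const_mul _).congr_deriv ?_
    norm_num
    ring
  have hright : ∀ v ∈ uIcc (1 - (1 - a) * Real.exp a) 1,
      HasDerivAt (fun v => -(Real.exp a / 2 * Real.exp (Real.exp (-a) * (1 - v)) ^ 2)
          + 2 * Real.exp (1 - a) * (((1 - v) * Real.exp a - Real.exp a ^ 2)
            * Real.exp (Real.exp (-a) * (1 - v)))
          - Real.exp (1 - a) ^ 2 * ((1 - v) ^ 3 / 3))
        ((Real.exp (Real.exp (-a) * (1 - v)) - (1 - v) * Real.exp (1 - a)) ^ 2) v := by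
    intro v _
    have h := hasDerivAt_one_sub v
    have he := (h.const_mul (Real.exp (-a))).exp
    refine ((((he.pow 2).const_mul (Real.exp a / 2)).neg.add
      ((((h.mul_const (Real.exp a)).sub_const (Real.exp a ^ 2)).mul he).const_mul
        (2 * Real.exp (1 - a)))).sub
      (((h.pow 3).div_const 3).const_mul (Real.exp (1 - a) ^ 2))).congr_deriv ?_
    rw [Real.exp_neg]
    field_simp
    norm_num
    ring
  rw [integral_eq_sub_of_hasDerivAt hleft (Continuous.intervalIntegrable (by fun_prop) _ _),
    integral_eq_sub_of_hasDerivAt hright (Continuous.intervalIntegrable (by fun_prop) _ _)]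
  have h : Real.exp (-a) * ((1 - a) * Real.exp a) = 1 - a := by
    rw [mul_left_comm, ← Real.exp_add]; simp
  simp only [sub_sub_cancel, h, sub_self, mul_zero, Real.exp_zero]
  rw [h1a, Real.exp_neg]
  field_simp
  ring

/-- The mean-zero quadratic whose samples serve as test vector. -/
noncomputable def testFun (x : ℝ) : ℝ := x ^ 2 - 7 / 5 * x + 11 / 30

/-- The conditional expectation of `testFun (G_a(V))` given `a`, in closed form. -/
noncomputable def condTestFun (a : ℝ) : ℝ :=
  (Real.exp 1 ^ 2 * Real.exp (-a) ^ 2 / 3 + (a - 1 / 2) * Real.exp 1 ^ 2 * Real.exp (-a)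
        + (1 + a ^ 2) * Real.exp 1 ^ 2 - (1 / 2 + 2 * Real.exp 1) * Real.exp a)
    - 7 / 5 * (Real.exp 1 * Real.exp (-a) / 2 + a * Real.exp 1 - Real.exp a) + 11 / 30

lemma continuous_testFun : Continuous testFun := by
  unfold testFun; fun_prop

lemma continuous_condTestFun : Continuous condTestFun := by
  unfold condTestFun; fun_prop

lemma integral_testFun_Gfun {a : ℝ} (ha : a ≤ 1) :
    ∫ v in (0 : ℝ)..1, testFun (Gfun a v) = condTestFun a := by
  have hc := continuous_Gfun a
  unfold testFun condTestFun
  rw [integral_add (Continuous.intervalIntegrable (by fun_prop) _ _)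
    (Continuous.intervalIntegrable (by fun_prop) _ _),
    integral_sub (Continuous.intervalIntegrable (by fun_prop) _ _)
    (Continuous.intervalIntegrable (by fun_prop) _ _), intervalIntegral.integral_const_mul,
    integral_Gfun ha, integral_Gfun_sq ha]
  simp

/-- The integral over the unit interval of a combination of powers of `exp` with polynomial
coefficients. -/
lemma integral_exp_poly (p₀ p₁ p₂ q₀ q₁ q₂ q₃ r₀ r₁ r₂ s₀ s₁ s₂ s₃ s₄ : ℝ) :
    ∫ a in (0 : ℝ)..1, ((p₀ + p₁ * a + p₂ * a ^ 2) * Real.exp (-a) ^ 2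
        + (q₀ + q₁ * a + q₂ * a ^ 2 + q₃ * a ^ 3) * Real.exp (-a)
        + (r₀ + r₁ * a + r₂ * a ^ 2) * Real.exp a
        + (s₀ + s₁ * a + s₂ * a ^ 2 + s₃ * a ^ 3 + s₄ * a ^ 4)) =
      (p₀ / 2 + p₁ / 4 + p₂ / 4)
        - (p₀ / 2 + p₁ * (3 / 4) + p₂ * (5 / 4)) * Real.exp (-1) ^ 2
        + (q₀ + q₁ + 2 * q₂ + 6 * q₃)
        - (q₀ + 2 * q₁ + 5 * q₂ + 16 * q₃) * Real.exp (-1)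
        + (r₀ + r₂) * Real.exp 1 - (r₀ - r₁ + 2 * r₂)
        + (s₀ + s₁ / 2 + s₂ / 3 + s₃ / 4 + s₄ / 5) := by
  have hd : ∀ a ∈ uIcc (0 : ℝ) 1, HasDerivAt (fun a : ℝ =>
      -(((p₀ / 2 + p₁ / 4 + p₂ / 4) + (p₁ / 2 + p₂ / 2) * a + p₂ / 2 * a ^ 2) * Real.exp (-a) ^ 2)
      - ((q₀ + q₁ + 2 * q₂ + 6 * q₃) + (q₁ + 2 * q₂ + 6 * q₃) * a + (q₂ + 3 * q₃) * a ^ 2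
          + q₃ * a ^ 3) * Real.exp (-a)
      + ((r₀ - r₁ + 2 * r₂) + (r₁ - 2 * r₂) * a + r₂ * a ^ 2) * Real.exp a
      + (s₀ * a + s₁ / 2 * a ^ 2 + s₂ / 3 * a ^ 3 + s₃ / 4 * a ^ 4 + s₄ / 5 * a ^ 5))
      ((p₀ + p₁ * a + p₂ * a ^ 2) * Real.exp (-a) ^ 2
        + (q₀ + q₁ * a + q₂ * a ^ 2 + q₃ * a ^ 3) * Real.exp (-a)
        + (r₀ + r₁ * a + r₂ * a ^ 2) * Real.exp a
        + (s₀ + s₁ * a + s₂ * a ^ 2 + s₃ * a ^ 3 + s₄ * a ^ 4)) a := by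
    intro a _
    have hn := (hasDerivAt_neg a).exp
    have hx := hasDerivAt_id' a
    have hpw (c : ℝ) (k : ℕ) := (hasDerivAt_pow k a).const_mul c
    refine (((((((hx.const_mul _).const_add _).add (hpw _ 2)).mul (hn.pow 2)).neg.sub
      (((((hx.const_mul _).const_add _).add (hpw _ 2)).add (hpw _ 3)).mul hn)).add
      ((((hx.const_mul _).const_add _).add (hpw _ 2)).mul (Real.hasDerivAt_exp a))).add
      (((((hx.const_mul _).add (hpw _ 2)).add (hpw _ 3)).add (hpw _ 4)).add
        (hpw _ 5))).congr_deriv ?_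
    norm_num
    ring
  rw [integral_eq_sub_of_hasDerivAt hd (Continuous.intervalIntegrable (by fun_prop) _ _)]
  norm_num
  ring

lemma integral_condTestFun : ∫ a in (0 : ℝ)..1, condTestFun a = 0 := by
  set e := Real.exp 1 with he
  have h := integral_exp_poly (e ^ 2 / 3) 0 0 (-(e ^ 2) / 2 - 7 / 10 * e) (e ^ 2) 0 0
    (9 / 10 - 2 * e) 0 0 (e ^ 2 + 11 / 30) (-(7 / 5) * e) (e ^ 2) 0 0
  have hx : Real.exp (-1) = e⁻¹ := by rw [Real.exp_neg]
  have hpos : 0 < e := Real.exp_pos 1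
  rw [hx, ← he] at h
  calc _ = _ := by
        refine integral_congr fun a _ => ?_
        simp only [condTestFun, ← he]
        ring
    _ = _ := h
    _ = 0 := by field_simp; ring

lemma integral_testFun : ∫ a in (0 : ℝ)..1, testFun a = 0 := by
  have h := integral_exp_poly 0 0 0 0 0 0 0 0 0 0 (11 / 30) (-(7 / 5)) 1 0 0
  calc _ = _ := by
        refine integral_congr fun a _ => ?_
        simp only [testFun]
        ring
    _ = _ := h
    _ = 0 := by norm_num

lemma integral_testFun_sq : ∫ a in (0 : ℝ)..1, testFun a ^ 2 = 17 / 900 := by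
  have h := integral_exp_poly 0 0 0 0 0 0 0 0 0 0 (121 / 900) (-(77 / 75)) (49 / 25 + 11 / 15)
    (-(14 / 5)) 1
  calc _ = _ := by
        refine integral_congr fun a _ => ?_
        simp only [testFun]
        ring
    _ = _ := h
    _ = _ := by norm_num

lemma integral_testFun_mul_condTestFun :
    0.0042 ≤ ∫ a in (0 : ℝ)..1, testFun a * condTestFun a := by
  set e := Real.exp 1 with he
  have h := integral_exp_poly (11 / 30 * (e ^ 2 / 3)) (-(7 / 5) * (e ^ 2 / 3)) (e ^ 2 / 3)
    (11 / 30 * (-(e ^ 2) / 2 - 7 / 10 * e))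
    (11 / 30 * e ^ 2 - 7 / 5 * (-(e ^ 2) / 2 - 7 / 10 * e))
    ((-(e ^ 2) / 2 - 7 / 10 * e) - 7 / 5 * e ^ 2) (e ^ 2)
    (11 / 30 * (9 / 10 - 2 * e)) (-(7 / 5) * (9 / 10 - 2 * e)) (9 / 10 - 2 * e)
    (11 / 30 * (e ^ 2 + 11 / 30)) (11 / 30 * (-(7 / 5) * e) - 7 / 5 * (e ^ 2 + 11 / 30))
    (11 / 30 * e ^ 2 - 7 / 5 * (-(7 / 5) * e) + (e ^ 2 + 11 / 30))
    (-(7 / 5) * e - 7 / 5 * e ^ 2) (e ^ 2)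
  have hx : Real.exp (-1) = e⁻¹ := by rw [Real.exp_neg]
  have hpos : 0 < e := Real.exp_pos 1
  rw [hx, ← he] at h
  refine le_of_le_of_eq ?_ (h.symm.trans (integral_congr fun a _ => ?_))
  swap
  · simp only [testFun, condTestFun, ← he]
    ring
  have h3 := Real.exp_one_gt_d9
  have h4 := Real.exp_one_lt_d9
  rw [← he] at h3 h4
  field_simp
  ring_nf
  nlinarith

open Matrix in
/-- Courant–Fischer lower bound for the second largest eigenvalue. -/
lemma Matrix.IsHermitian.le_eigenvalues₀_one {ι : Type*} [Fintype ι] [DecidableEq ι]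
    {A : Matrix ι ι ℝ} (hA : A.IsHermitian) (h1 : 1 < Fintype.card ι) {x y : ι → ℝ} {c : ℝ}
    (h : ∀ α β : ℝ, (α ≠ 0 ∨ β ≠ 0) →
      c * ((α • x + β • y) ⬝ᵥ (α • x + β • y)) < (α • x + β • y) ⬝ᵥ (A *ᵥ (α • x + β • y))) :
    c ≤ hA.eigenvalues₀ ⟨1, h1⟩ := by
  set b := hA.eigenvectorBasis
  have hexp (v w : ι → ℝ) : v ⬝ᵥ w = ∑ i, (⇑(b i) ⬝ᵥ v) * (⇑(b i) ⬝ᵥ w) := by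
    have := b.sum_inner_mul_inner (WithLp.toLp 2 v) (WithLp.toLp 2 w)
    simp only [EuclideanSpace.inner_eq_star_dotProduct, star_trivial] at this
    rw [dotProduct_comm v w, ← this]
    refine Finset.sum_congr rfl fun i _ => ?_
    rw [dotProduct_comm w]
  have heig (i : ι) (v : ι → ℝ) :
      ⇑(b i) ⬝ᵥ (A *ᵥ v) = hA.eigenvalues i * (⇑(b i) ⬝ᵥ v) := by
    have hT : Aᵀ = A := by simpa using hA.eq
    rw [dotProduct_mulVec, ← mulVec_transpose, hT, hA.mulVec_eigenvectorBasis, smul_dotProduct,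
      smul_eq_mul]
  set σ := Fintype.equivOfCardEq (Fintype.card_fin (Fintype.card ι)) (β := ι)
  set i₀ : ι := σ ⟨0, by omega⟩ with hi₀
  have hle (i : ι) (hi : i ≠ i₀) : hA.eigenvalues i ≤ hA.eigenvalues₀ ⟨1, h1⟩ := by
    refine hA.eigenvalues₀_antitone ?_
    have : σ.symm i ≠ ⟨0, by omega⟩ := fun hσ => hi (by rw [hi₀, ← hσ, Equiv.apply_symm_apply])
    rw [Fin.le_def]
    rw [Ne, Fin.ext_iff] at this
    exact Nat.one_le_iff_ne_zero.2 this
  obtain ⟨α, β, hne, horth⟩ : ∃ α β : ℝ, (α ≠ 0 ∨ β ≠ 0) ∧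
      ⇑(b i₀) ⬝ᵥ (α • x + β • y) = 0 := by
    by_cases hx : ⇑(b i₀) ⬝ᵥ x = 0
    · exact ⟨1, 0, by simp, by simp [hx]⟩
    · refine ⟨⇑(b i₀) ⬝ᵥ y, -(⇑(b i₀) ⬝ᵥ x), Or.inr (neg_ne_zero.2 hx), ?_⟩
      simp only [dotProduct_add, dotProduct_smul, smul_eq_mul]
      ring
  specialize h α β hne
  set v := α • x + β • y
  by_contra! hlt
  refine h.not_ge ?_
  rw [hexp v (A *ᵥ v), hexp v v, Finset.mul_sum]
  refine Finset.sum_le_sum fun i _ => ?_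
  rw [heig]
  by_cases hi : i = i₀
  · simp [hi, horth]
  · nlinarith [hle i hi, mul_self_nonneg (⇑(b i) ⬝ᵥ v)]

lemma abs_testFun_le {x : ℝ} (hx : x ∈ Icc (0 : ℝ) 1) : |testFun x| ≤ 2 / 5 := by
  obtain ⟨h0, h1⟩ := hx
  unfold testFun
  rw [abs_le]
  constructor <;> nlinarith [sq_nonneg (x - 7 / 10)]

lemma abs_testFun_sub_le {x y ε : ℝ} (hx : x ∈ Icc (0 : ℝ) 1) (hy : y ∈ Icc (0 : ℝ) 1)
    (h : |x - y| ≤ ε) : |testFun x - testFun y| ≤ 7 / 5 * ε := by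
  have : testFun x - testFun y = (x + y - 7 / 5) * (x - y) := by unfold testFun; ring
  rw [this, abs_mul]
  have h2 : |x + y - 7 / 5| ≤ 7 / 5 := by
    rw [abs_le]; constructor <;> linarith [hx.1, hx.2, hy.1, hy.2]
  gcongr

lemma Gfun_mem {a : ℝ} (ha : a ∈ Icc (0 : ℝ) 1) {v : ℝ} (hv : v ∈ Icc (0 : ℝ) 1) :
    Gfun a v ∈ Icc (0 : ℝ) 1 := by
  have hm := (strictMono_Gfun ha.1).monotone
  constructor
  · simpa [Gfun_zero] using hm hv.1
  · simpa [Gfun_one ha.2] using hm hv.2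

lemma abs_condTestFun_le {a : ℝ} (ha : a ∈ Icc (0 : ℝ) 1) : |condTestFun a| ≤ 2 / 5 := by
  rw [← integral_testFun_Gfun ha.2]
  have := intervalIntegral.norm_integral_le_of_norm_le_const (a := 0) (b := 1) (C := 2 / 5)
    (f := fun v => testFun (Gfun a v)) fun v hv => by
      rw [uIoc_of_le zero_le_one] at hv
      exact abs_testFun_le (Gfun_mem ha (Ioc_subset_Icc_self hv))
  simpa using this

/-- The discretized conditional expectation of `testFun (G_a(V))`. -/
noncomputable def condTestSum (n : ℕ) (a : ℝ) : ℝ :=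
  ∑ j ∈ Finset.range n, testFun ((j : ℝ) / n) *
    (Ginv a (((j : ℝ) + 1) / n) - Ginv a ((j : ℝ) / n))

lemma div_mem_unitInterval {n j : ℕ} (hj : j ≤ n) : (j : ℝ) / n ∈ Icc (0 : ℝ) 1 :=
  ⟨by positivity, div_le_one_of_le₀ (by exact_mod_cast hj) (by positivity)⟩

lemma succ_div_mem_unitInterval {n j : ℕ} (hj : j < n) : ((j : ℝ) + 1) / n ∈ Icc (0 : ℝ) 1 := by
  exact_mod_cast div_mem_unitInterval (n := n) (j := j + 1) hj

lemma div_le_succ_div (n j : ℕ) : (j : ℝ) / n ≤ ((j : ℝ) + 1) / n := by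
  gcongr; linarith

lemma abs_div_sub_le {n j : ℕ} {x : ℝ} (hx : x ∈ Icc ((j : ℝ) / n) (((j : ℝ) + 1) / n)) :
    |(j : ℝ) / n - x| ≤ 1 / n := by
  have h1 := hx.1
  have h2 := hx.2
  rw [add_div] at h2
  have h3 : (0 : ℝ) ≤ 1 / n := by positivity
  rw [abs_le]
  constructor <;> linarith

lemma abs_condTestSum_sub_le {n : ℕ} (hn : 0 < n) {a : ℝ} (ha : a ∈ Icc (0 : ℝ) 1) :
    |condTestSum n a - condTestFun a| ≤ 7 / 5 * (1 / n) := by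
  have hn0 : (n : ℝ) ≠ 0 := by positivity
  have key := abs_sum_integral_sub_le (n := n) (p := fun j => Ginv a ((j : ℝ) / n))
    (k := fun j _ => testFun ((j : ℝ) / n)) (g := fun v => testFun (Gfun a v))
    (ε := 7 / 5 * (1 / n)) ?_ (by simp [Ginv_zero ha.1]) (by simp [div_self hn0, Ginv_one ha])
    (by simp) (continuous_testFun.comp (continuous_Gfun a)) ?_
  · rw [integral_testFun_Gfun ha.2] at key
    convert key using 4
    refine Finset.sum_congr rfl fun j _ => ?_
    simp [mul_comm]
  · intro j hj
    push_cast
    exact Ginv_mono ha (div_mem_unitInterval hj.le) (succ_div_mem_unitInterval hj)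
      (div_le_succ_div n j)
  · intro j hj v hv
    push_cast at hv
    have hm := (strictMono_Gfun ha.1).monotone
    have h1 := hm hv.1
    have h2 := hm hv.2
    rw [Gfun_Ginv ha (div_mem_unitInterval hj.le)] at h1
    rw [Gfun_Ginv ha (succ_div_mem_unitInterval hj)] at h2
    exact abs_testFun_sub_le (div_mem_unitInterval hj.le)
      ⟨(div_mem_unitInterval hj.le).1.trans h1, h2.trans (succ_div_mem_unitInterval hj).2⟩
      (abs_div_sub_le ⟨h1, h2⟩)

lemma intervalIntegrable_Ginv {n i : ℕ} (hi : i < n) {x : ℝ} (hx : x ∈ Icc (0 : ℝ) 1) :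
    IntervalIntegrable (fun a => Ginv a x) volume ((i : ℝ) / n) (((i : ℝ) + 1) / n) := by
  rw [intervalIntegrable_iff_integrableOn_Icc_of_le (div_le_succ_div n i)]
  exact (integrableOn_Ginv hx).mono_set
    (Icc_subset_Icc (div_mem_unitInterval hi.le).1 (succ_div_mem_unitInterval hi).2)

lemma intervalIntegrable_Ginv_sub {n i j : ℕ} (hi : i < n) (hj : j < n) :
    IntervalIntegrable (fun a => Ginv a (((j : ℝ) + 1) / n) - Ginv a ((j : ℝ) / n)) volume
      ((i : ℝ) / n) (((i : ℝ) + 1) / n) :=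
  (intervalIntegrable_Ginv hi (succ_div_mem_unitInterval hj)).sub
    (intervalIntegrable_Ginv hi (div_mem_unitInterval hj.le))

lemma intervalIntegrable_condTestSum {n i : ℕ} (hi : i < n) :
    IntervalIntegrable (condTestSum n) volume ((i : ℝ) / n) (((i : ℝ) + 1) / n) := by
  have : condTestSum n = ∑ j ∈ Finset.range n, fun a => testFun ((j : ℝ) / n) *
    (Ginv a (((j : ℝ) + 1) / n) - Ginv a ((j : ℝ) / n)) := by
    ext a; simp [condTestSum]
  rw [this]
  exact IntervalIntegrable.sum _ fun j hj =>
    (intervalIntegrable_Ginv_sub hi (Finset.mem_range.1 hj)).const_mul _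

lemma sum_Bmat_mul (n : ℕ) (i : Fin n) (w : ℕ → ℝ) :
    ∑ j : Fin n, Bmat n i j * w j = n * ∫ a in ((i.val : ℝ) / n)..(((i.val : ℝ) + 1) / n),
      ∑ j ∈ Finset.range n, w j * (Ginv a (((j : ℝ) + 1) / n) - Ginv a ((j : ℝ) / n)) := by
  rw [intervalIntegral.integral_finsetSum fun j hj =>
    (intervalIntegrable_Ginv_sub i.2 (Finset.mem_range.1 hj)).const_mul _, Finset.mul_sum,
    ← Fin.sum_univ_eq_sum_range (fun j => (n : ℝ) *
      ∫ a in ((i.val : ℝ) / n)..(((i.val : ℝ) + 1) / n),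
        w j * (Ginv a (((j : ℝ) + 1) / n) - Ginv a ((j : ℝ) / n)))]
  refine Finset.sum_congr rfl fun j _ => ?_
  rw [intervalIntegral.integral_const_mul, Bmat]
  ring

lemma sum_Bmat {n : ℕ} (i : Fin n) : ∑ j : Fin n, Bmat n i j = 1 := by
  have h := sum_Bmat_mul n i fun _ => 1
  simp only [mul_one, one_mul] at h
  have hn0 : (n : ℝ) ≠ 0 := by
    have := i.pos
    positivity
  rw [h, integral_congr (g := fun _ => 1) fun a ha => ?_]
  · simp only [intervalIntegral.integral_const, smul_eq_mul]
    field_simp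
    ring
  · rw [uIcc_of_le (div_le_succ_div n i)] at ha
    have ha01 : a ∈ Icc (0 : ℝ) 1 :=
      ⟨(div_mem_unitInterval i.2.le).1.trans ha.1, ha.2.trans (succ_div_mem_unitInterval i.2).2⟩
    have := Finset.sum_range_sub (fun j : ℕ => Ginv a ((j : ℝ) / n)) n
    push_cast at this
    simp only [this, div_self hn0, Ginv_one ha01, zero_div, Ginv_zero ha01.1, sub_zero]

/-- The Riemann-sum estimate specialised to the uniform partition. -/
lemma abs_sum_integral_div_sub_le {n : ℕ} (hn : 0 < n) {k : ℕ → ℝ → ℝ} {g : ℝ → ℝ} {ε : ℝ}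
    (hk : ∀ i < n, IntervalIntegrable (k i) volume ((i : ℝ) / n) (((i : ℝ) + 1) / n))
    (hg : Continuous g)
    (h : ∀ i < n, ∀ x ∈ Icc (0 : ℝ) 1, |(i : ℝ) / n - x| ≤ 1 / n → |k i x - g x| ≤ ε) :
    |∑ i : Fin n, (∫ x in ((i.val : ℝ) / n)..(((i.val : ℝ) + 1) / n), k i x)
      - ∫ x in (0 : ℝ)..1, g x| ≤ ε := by
  have hn0 : (n : ℝ) ≠ 0 := by positivity
  have key := abs_sum_integral_sub_le (n := n) (p := fun j => (j : ℝ) / n) (k := k) (g := g)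
    (ε := ε)
  push_cast at key
  rw [Fin.sum_univ_eq_sum_range
    (fun i => ∫ x in ((i : ℝ) / n)..(((i : ℝ) + 1) / n), k i x)]
  refine key (fun i _ => div_le_succ_div n i) (by simp) (div_self hn0) hk hg fun i hi x hx => ?_
  exact h i hi x ⟨(div_mem_unitInterval hi.le).1.trans hx.1,
    hx.2.trans (succ_div_mem_unitInterval hi).2⟩ (abs_div_sub_le hx)

/-- The samples of `testFun` along the uniform grid. -/
noncomputable def testVec (n : ℕ) (i : Fin n) : ℝ := testFun ((i.val : ℝ) / n)

lemma integral_const_cell {n : ℕ} (hn : 0 < n) (i : ℕ) (c : ℝ) :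
    ∫ _x in ((i : ℝ) / n)..(((i : ℝ) + 1) / n), c = c / n := by
  simp only [intervalIntegral.integral_const, smul_eq_mul]
  field_simp
  ring

lemma abs_sum_testVec_le {n : ℕ} (hn : 0 < n) :
    |(∑ i, testVec n i) / n| ≤ 7 / 5 * (1 / n) := by
  have h := abs_sum_integral_div_sub_le hn (k := fun i _ => testFun ((i : ℝ) / n)) (g := testFun)
    (ε := 7 / 5 * (1 / n)) (by simp) continuous_testFun
    fun i hi x hx hix => abs_testFun_sub_le (div_mem_unitInterval hi.le) hx hix
  simp only [integral_const_cell hn, integral_testFun, sub_zero] at h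
  rwa [Finset.sum_div]

lemma abs_mul_sub_mul_le {a b c d M ε δ : ℝ} (ha : |a| ≤ M) (hd : |d| ≤ M) (h1 : |a - c| ≤ ε)
    (h2 : |b - d| ≤ δ) : |a * b - c * d| ≤ M * δ + ε * M := by
  have : a * b - c * d = a * (b - d) + (a - c) * d := by ring
  rw [this]
  refine (abs_add_le _ _).trans ?_
  rw [abs_mul, abs_mul]
  have := (abs_nonneg a).trans ha
  have := (abs_nonneg _).trans h1
  gcongr

lemma abs_sum_testVec_sq_sub_le {n : ℕ} (hn : 0 < n) :
    |(∑ i, testVec n i ^ 2) / n - 17 / 900| ≤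
      2 / 5 * (7 / 5 * (1 / n)) + 7 / 5 * (1 / n) * (2 / 5) := by
  have hc := continuous_testFun
  have h := abs_sum_integral_div_sub_le hn (k := fun i _ => testFun ((i : ℝ) / n) ^ 2)
    (g := fun x => testFun x ^ 2)
    (ε := 2 / 5 * (7 / 5 * (1 / n)) + 7 / 5 * (1 / n) * (2 / 5)) (by simp) (by fun_prop)
    fun i hi x hx hix => by
      have hL := abs_testFun_sub_le (div_mem_unitInterval hi.le) hx hix
      rw [sq, sq]
      exact abs_mul_sub_mul_le (abs_testFun_le (div_mem_unitInterval hi.le)) (abs_testFun_le hx)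
        hL hL
  simp only [integral_const_cell hn, integral_testFun_sq] at h
  rwa [Finset.sum_div]

open Matrix

lemma Bmat_mulVec_testVec (n : ℕ) (i : Fin n) :
    (Bmat n *ᵥ testVec n) i =
      n * ∫ a in ((i.val : ℝ) / n)..(((i.val : ℝ) + 1) / n), condTestSum n a :=
  sum_Bmat_mul n i fun j => testFun ((j : ℝ) / n)

lemma abs_sum_Bmat_mulVec_testVec_le {n : ℕ} (hn : 0 < n) :
    |(∑ i, (Bmat n *ᵥ testVec n) i) / n| ≤ 7 / 5 * (1 / n) := by
  have h := abs_sum_integral_div_sub_le hn (k := fun _ => condTestSum n) (g := condTestFun)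
    (ε := 7 / 5 * (1 / n)) (fun i hi => intervalIntegrable_condTestSum hi) continuous_condTestFun
    fun i hi x hx hix => abs_condTestSum_sub_le hn hx
  rw [integral_condTestFun, sub_zero] at h
  convert h using 2
  rw [Finset.sum_div]
  refine Finset.sum_congr rfl fun i _ => ?_
  rw [Bmat_mulVec_testVec]
  field_simp

lemma testVec_dotProduct_Bmat_mulVec_ge {n : ℕ} (hn : 0 < n) :
    0.0042 - (2 / 5 * (7 / 5 * (1 / n)) + 7 / 5 * (1 / n) * (2 / 5)) ≤
      (testVec n ⬝ᵥ Bmat n *ᵥ testVec n) / n := by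
  have h := abs_sum_integral_div_sub_le hn
    (k := fun i a => testFun ((i : ℝ) / n) * condTestSum n a)
    (g := fun a => testFun a * condTestFun a)
    (ε := 2 / 5 * (7 / 5 * (1 / n)) + 7 / 5 * (1 / n) * (2 / 5))
    (fun i hi => (intervalIntegrable_condTestSum hi).const_mul _)
    (continuous_testFun.mul continuous_condTestFun)
    fun i hi x hx hix => abs_mul_sub_mul_le (abs_testFun_le (div_mem_unitInterval hi.le))
      (abs_condTestFun_le hx) (abs_testFun_sub_le (div_mem_unitInterval hi.le) hx hix)
      (abs_condTestSum_sub_le hn hx)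
  have h2 : (testVec n ⬝ᵥ Bmat n *ᵥ testVec n) / n =
      ∑ i : Fin n, ∫ a in ((i.val : ℝ) / n)..(((i.val : ℝ) + 1) / n),
        testFun ((i.val : ℝ) / n) * condTestSum n a := by
    rw [dotProduct, Finset.sum_div]
    refine Finset.sum_congr rfl fun i _ => ?_
    rw [Bmat_mulVec_testVec, intervalIntegral.integral_const_mul, testVec]
    field_simp
  rw [h2]
  have h3 := integral_testFun_mul_condTestFun
  linarith [(abs_le.1 h).1]

lemma dotProduct_symmetrization_mulVec {ι : Type*} [Fintype ι] (B : Matrix ι ι ℝ) (v : ι → ℝ) :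
    v ⬝ᵥ ((2 : ℝ)⁻¹ • (B + Bᵀ)) *ᵥ v = v ⬝ᵥ B *ᵥ v := by
  have h : v ⬝ᵥ Bᵀ *ᵥ v = v ⬝ᵥ B *ᵥ v := by
    rw [mulVec_transpose, dotProduct_comm, ← dotProduct_mulVec]
  rw [smul_mulVec, dotProduct_smul, add_mulVec, dotProduct_add, h, smul_eq_mul]
  ring

lemma rayleigh_bound {n : ℕ} (hn : 10 ^ 5 ≤ n) {α β : ℝ} (hne : α ≠ 0 ∨ β ≠ 0) :
    0.21 * ((α • (fun _ => 1) + β • testVec n) ⬝ᵥ (α • (fun _ => 1) + β • testVec n)) <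
      (α • (fun _ => 1) + β • testVec n) ⬝ᵥ
        (((2 : ℝ)⁻¹ • (Bmat n + (Bmat n)ᵀ)) *ᵥ (α • (fun _ => 1) + β • testVec n)) := by
  have hn1 : 0 < n := by omega
  have hnpos : (0 : ℝ) < n := by exact_mod_cast hn1
  have hB1 : Bmat n *ᵥ (fun _ => 1) = fun _ => 1 := by
    ext i
    simp [mulVec, dotProduct, sum_Bmat]
  rw [dotProduct_symmetrization_mulVec, mulVec_add, mulVec_smul, mulVec_smul, hB1]
  have hS := abs_sum_testVec_le hn1
  have hQ := abs_sum_testVec_sq_sub_le hn1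
  have hU := abs_sum_Bmat_mulVec_testVec_le hn1
  have hV := testVec_dotProduct_Bmat_mulVec_ge hn1
  set S := (∑ i, testVec n i) / n with hSdef
  set Q := (∑ i, testVec n i ^ 2) / n with hQdef
  set U := (∑ i, (Bmat n *ᵥ testVec n) i) / n with hUdef
  set V := (testVec n ⬝ᵥ Bmat n *ᵥ testVec n) / n with hVdef
  have hL : (α • (fun _ => (1 : ℝ)) + β • testVec n) ⬝ᵥ (α • (fun _ => 1) + β • testVec n) =
      n * (α ^ 2 + 2 * α * β * S + β ^ 2 * Q) := by
    have e1 : (fun _ => (1 : ℝ)) ⬝ᵥ (fun _ : Fin n => (1 : ℝ)) = n := by simp [dotProduct]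
    have e2 : (fun _ => (1 : ℝ)) ⬝ᵥ testVec n = n * S := by
      rw [hSdef]; simp [dotProduct]; field_simp
    have e3 : testVec n ⬝ᵥ testVec n = n * Q := by
      rw [hQdef]; simp only [dotProduct, ← sq]; field_simp
    simp only [add_dotProduct, dotProduct_add, smul_dotProduct, dotProduct_smul, smul_eq_mul,
      dotProduct_comm (testVec n) (fun _ => (1 : ℝ)), e1, e2, e3]
    ring
  have hR : (α • (fun _ => (1 : ℝ)) + β • testVec n) ⬝ᵥ
      (α • (fun _ => 1) + β • (Bmat n *ᵥ testVec n)) =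
      n * (α ^ 2 + α * β * (S + U) + β ^ 2 * V) := by
    have e1 : (fun _ => (1 : ℝ)) ⬝ᵥ (fun _ : Fin n => (1 : ℝ)) = n := by simp [dotProduct]
    have e2 : testVec n ⬝ᵥ (fun _ => (1 : ℝ)) = n * S := by
      rw [hSdef]; simp [dotProduct]; field_simp
    have e3 : (fun _ => (1 : ℝ)) ⬝ᵥ (Bmat n *ᵥ testVec n) = n * U := by
      rw [hUdef]; simp only [dotProduct, one_mul]; field_simp
    have e4 : testVec n ⬝ᵥ Bmat n *ᵥ testVec n = n * V := by
      rw [hVdef]; field_simp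
    simp only [add_dotProduct, dotProduct_add, smul_dotProduct, dotProduct_smul, smul_eq_mul,
      e1, e2, e3, e4]
    ring
  rw [hL, hR, mul_left_comm]
  refine mul_lt_mul_of_pos_left ?_ hnpos
  have hinv : (1 : ℝ) / n ≤ 1 / 10 ^ 5 := by
    have : (10 : ℝ) ^ 5 ≤ n := by exact_mod_cast hn
    gcongr
  rw [abs_le] at hS hQ hU
  generalize (1 : ℝ) / n = t at *
  have hq : 0.0001 ≤ V - 0.21 * Q := by linarith [hQ.2]
  have hs1 : -0.0001 ≤ 0.58 * S + U := by linarith [hS.1, hU.1]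
  have hs2 : 0.58 * S + U ≤ 0.0001 := by linarith [hS.2, hU.2]
  set s := 0.58 * S + U
  set q := V - 0.21 * Q
  suffices 0 < 0.79 * α ^ 2 + s * (α * β) + q * β ^ 2 by
    simp only [s, q] at this
    linarith
  have hab : |s * (α * β)| ≤ 0.0001 * ((α ^ 2 + β ^ 2) / 2) := by
    rw [abs_mul]
    have h1 : |s| ≤ 0.0001 := abs_le.2 ⟨hs1, hs2⟩
    have h2 : |α * β| ≤ (α ^ 2 + β ^ 2) / 2 := by
      rw [abs_le]; constructor <;> nlinarith [sq_nonneg (α + β), sq_nonneg (α - β)]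
    gcongr
  have hpos : 0 < α ^ 2 + β ^ 2 := by
    rcases hne with h | h <;> positivity
  have hqb : 0.0001 * β ^ 2 ≤ q * β ^ 2 := by gcongr
  have := (abs_le.1 hab).1
  nlinarith [sq_nonneg α, sq_nonneg β]

open Polynomial Matrix in
/-- For every `n ≥ 10⁵`, the second largest eigenvalue — in the decreasing enumeration `μ`,
with multiplicity, of the `n` real eigenvalues (i.e. the roots of the characteristic
polynomial) — of the real symmetric matrix `S(n) = (B(n) + B(n)ᵀ)/2` is at least `0.21`. -/
theorem Smat_second_eigenvalue (n : ℕ) (hn : 10 ^ 5 ≤ n) :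
    ∃ μ : Fin n → ℝ,
      (∀ i j : Fin n, i ≤ j → μ j ≤ μ i) ∧
      ((2 : ℝ)⁻¹ • (Bmat n + (Bmat n)ᵀ)).charpoly = ∏ i : Fin n, (X - C (μ i)) ∧
      (0.21 : ℝ) ≤ μ ⟨1, by omega⟩ := by
  have hA : ((2 : ℝ)⁻¹ • (Bmat n + (Bmat n)ᵀ)).IsHermitian := by
    simp only [Matrix.IsHermitian, conjTranspose_eq_transpose_of_trivial, transpose_smul,
      transpose_add, transpose_transpose, add_comm]
  have hcard : Fintype.card (Fin n) = n := Fintype.card_fin n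
  refine ⟨fun i => hA.eigenvalues₀ (Fin.cast hcard.symm i), fun i j hij =>
    hA.eigenvalues₀_antitone (by simpa using hij), ?_, ?_⟩
  · rw [hA.charpoly_eq]
    refine Fintype.prod_equiv ((Fintype.equivOfCardEq (Fintype.card_fin _)).symm.trans
      (finCongr hcard)) _ _ fun i => ?_
    rfl
  · exact hA.le_eigenvalues₀_one (by omega) fun α β hne => rayleigh_bound hn hne
end
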